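/- (Duality of one-variable multiple polylogarithms.) For every admissible augmented index k̃ and every real z with 0 ≤ z < 1, one has L̃i(k̃; z) = L̃i(k̃†; z), where k̃† is the dual admissible augmented index of k̃. -/

import Mathlib

/-- An augmented index: a tuple of pairs (k_i, μ_i) with μ_i ∈ {0,1};
`true` encodes μ = 1 and `false` encodes μ = 0. -/
abbrev AugIndex := List (ℕ × Bool)

/-- All exponents k_i of the augmented index are positive integers. -/
def AugIndex.Valid (K : AugIndex) : Prop := ∀ p ∈ K, 1 ≤ p.1

/-- An augmented index is admissible if it is empty or its last entry is not (1,1). -/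
def AugIndex.Admissible (K : AugIndex) : Prop := K.getLast? ≠ some (1, true)

/-- The three-letter alphabet {x, y₀, y₁}. -/
inductive Letter | x | y0 | y1
deriving DecidableEq

/-- Exchange x ↔ y₁, leaving y₀ fixed. -/
def swapLetter : Letter → Letter
  | .x => .y1
  | .y1 => .x
  | .y0 => .y0

/-- The word w(k̃) = y_{μ_1} x^{k_1−1} ⋯ y_{μ_r} x^{k_r−1}. -/
def word (K : AugIndex) : List Letter :=
  K.flatMap fun p => (if p.2 then Letter.y1 else Letter.y0) :: List.replicate (p.1 - 1) Letter.x

/-- The strictly increasing chain 0 = m_0 < m_1 < ⋯ < m_r encoded by gaps `d`: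
m_i = (d_0 + 1) + ⋯ + (d_{i-1} + 1). -/
def chain {r : ℕ} (d : Fin r → ℕ) (i : ℕ) : ℕ :=
  ∑ j ∈ Finset.univ.filter (fun j : Fin r => (j : ℕ) < i), (d j + 1)

/-- The factor (μ_i + (−1)^{μ_i} z^{m_i − m_{i−1}}) / m_i^{k_i}. -/
noncomputable def termFactor (z : ℝ) (k : ℕ) (μ : Bool) (mprev mcur : ℕ) : ℝ :=
  ((if μ then 1 else 0) + (if μ then -1 else 1) * z ^ (mcur - mprev)) / (mcur : ℝ) ^ k

/-- The one-variable multiple polylogarithm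
L̃i(k̃; z) = ∑_{0=m_0<m_1<⋯<m_r} ∏_i (μ_i + (−1)^{μ_i} z^{m_i−m_{i−1}})/m_i^{k_i}. -/
noncomputable def Li (K : AugIndex) (z : ℝ) : ℝ :=
  ∑' d : Fin K.length → ℕ,
    ∏ i : Fin K.length,
      termFactor z (K.get i).1 (K.get i).2 (chain d i.val) (chain d (i.val + 1))

open MeasureTheory Set
open scoped ENNReal

/-- The density of the differential form on `(0, 1)` attached to a letter. -/
noncomputable def letterDensity (z : ℝ) : Letter → ℝ → ℝ≥0∞
  | .x, t => ENNReal.ofReal (1 / t)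
  | .y0, t => ENNReal.ofReal (z / (1 - z * t))
  | .y1, t => ENNReal.ofReal ((1 - z) / ((1 - t) * (1 - z * t)))

/-- The iterated integral from `0` to `t`, the head of the word being the outermost form. -/
noncomputable def lowerInt (z : ℝ) : List Letter → ℝ → ℝ≥0∞
  | [], _ => 1
  | a :: w, t => ∫⁻ s in Ioo 0 t, letterDensity z a s * lowerInt z w s

/-- The iterated integral from `t` to `1`, the head of the word being the outermost form. -/
noncomputable def upperInt (z : ℝ) : List Letter → ℝ → ℝ≥0∞
  | [], _ => 1
  | a :: w, t => ∫⁻ s in Ioo t 1, letterDensity z a s * upperInt z w s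

/-- The Möbius involution of `[0, 1]` exchanging `0` and `1` which realises duality. -/
noncomputable def dualMap (z t : ℝ) : ℝ := (1 - t) / (1 - z * t)

lemma measurable_letterDensity (z : ℝ) (a : Letter) : Measurable (letterDensity z a) := by
  cases a <;> unfold letterDensity <;> fun_prop

lemma measurable_lowerInt (z : ℝ) (w : List Letter) : Measurable (lowerInt z w) := by
  cases w with
  | nil => exact measurable_const
  | cons a w =>
    exact Monotone.measurable fun s t hst => lintegral_mono_set (Ioo_subset_Ioo_right hst)

lemma measurable_upperInt (z : ℝ) (w : List Letter) : Measurable (upperInt z w) := by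
  cases w with
  | nil => exact measurable_const
  | cons a w =>
    exact Antitone.measurable fun s t hst => lintegral_mono_set (Ioo_subset_Ioo_left hst)

/-- Tonelli's theorem on the triangle `0 < s < t < 1`. -/
lemma lintegral_triangle_swap {A B : ℝ → ℝ≥0∞} (hA : Measurable A) (hB : Measurable B) :
    ∫⁻ s in Ioo (0 : ℝ) 1, A s * ∫⁻ t in Ioo s 1, B t
      = ∫⁻ t in Ioo (0 : ℝ) 1, B t * ∫⁻ s in Ioo 0 t, A s := by
  have hT : MeasurableSet {p : ℝ × ℝ | 0 < p.1 ∧ p.1 < p.2 ∧ p.2 < 1} :=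
    (measurableSet_lt measurable_const measurable_fst).inter
      ((measurableSet_lt measurable_fst measurable_snd).inter
        (measurableSet_lt measurable_snd measurable_const))
  set F : ℝ × ℝ → ℝ≥0∞ :=
    {p : ℝ × ℝ | 0 < p.1 ∧ p.1 < p.2 ∧ p.2 < 1}.indicator fun p => A p.1 * B p.2 with hF
  have hFm : Measurable F :=
    ((hA.comp measurable_fst).mul (hB.comp measurable_snd)).indicator hT
  have hleft : ∫⁻ s in Ioo (0 : ℝ) 1, A s * ∫⁻ t in Ioo s 1, B t = ∫⁻ s, ∫⁻ t, F (s, t) := by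
    rw [← lintegral_indicator measurableSet_Ioo]
    refine lintegral_congr fun s => ?_
    by_cases hs : s ∈ Ioo (0 : ℝ) 1
    · rw [indicator_of_mem hs, ← lintegral_const_mul _ hB,
        ← lintegral_indicator measurableSet_Ioo]
      refine lintegral_congr fun t => ?_
      simp only [hF, indicator, mem_Ioo, mem_ofPred_eq, hs.1, true_and]
    · rw [indicator_of_notMem hs]
      symm
      refine (lintegral_congr fun t => ?_).trans lintegral_zero
      exact indicator_of_notMem (fun h => hs ⟨h.1, h.2.1.trans h.2.2⟩) _
  have hright : ∫⁻ t in Ioo (0 : ℝ) 1, B t * ∫⁻ s in Ioo 0 t, A s = ∫⁻ t, ∫⁻ s, F (s, t) := by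
    rw [← lintegral_indicator measurableSet_Ioo]
    refine lintegral_congr fun t => ?_
    by_cases ht : t ∈ Ioo (0 : ℝ) 1
    · rw [indicator_of_mem ht, ← lintegral_const_mul _ hA,
        ← lintegral_indicator measurableSet_Ioo]
      refine lintegral_congr fun s => ?_
      simp only [hF, indicator, mem_Ioo, mem_ofPred_eq, ht.2, and_true, mul_comm]
    · rw [indicator_of_notMem ht]
      symm
      refine (lintegral_congr fun s => ?_).trans lintegral_zero
      exact indicator_of_notMem (fun h => ht ⟨h.1.trans h.2.1, h.2.2⟩) _
  rw [hleft, hright]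
  exact lintegral_lintegral_swap hFm.aemeasurable

lemma lintegral_lowerInt_mul_upperInt (z : ℝ) (v : List Letter) :
    ∀ (u : List Letter) (a : Letter),
      ∫⁻ s in Ioo (0 : ℝ) 1, letterDensity z a s * lowerInt z u s * upperInt z v s
        = lowerInt z (v.reverse ++ a :: u) 1 := by
  induction v with
  | nil => intro u a; simp [upperInt, lowerInt]
  | cons b v ih =>
    intro u a
    have h := lintegral_triangle_swap
      ((measurable_letterDensity z a).mul (measurable_lowerInt z u))
      ((measurable_letterDensity z b).mul (measurable_upperInt z v))
    simp only [Pi.mul_apply] at h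
    rw [List.reverse_cons, List.append_assoc, List.singleton_append, ← ih (a :: u) b]
    refine h.trans (lintegral_congr fun t => ?_)
    rw [lowerInt, mul_right_comm]

lemma lowerInt_reverse_one (z : ℝ) (w : List Letter) :
    lowerInt z w.reverse 1 = upperInt z w 0 := by
  cases w with
  | nil => rfl
  | cons a w =>
    rw [List.reverse_cons, ← lintegral_lowerInt_mul_upperInt z w [] a]
    simp [upperInt, lowerInt]

section dualMap

variable {z t : ℝ}

lemma one_sub_mul_pos (hz0 : 0 ≤ z) (hz1 : z < 1) (ht : t ≤ 1) : 0 < 1 - z * t := by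
  nlinarith

lemma one_sub_dualMap (hz0 : 0 ≤ z) (hz1 : z < 1) (ht : t ≤ 1) :
    1 - dualMap z t = (1 - z) * t / (1 - z * t) := by
  rw [dualMap, eq_div_iff (one_sub_mul_pos hz0 hz1 ht).ne', sub_mul, div_mul_cancel₀ _
    (one_sub_mul_pos hz0 hz1 ht).ne']
  ring

lemma one_sub_mul_dualMap (hz0 : 0 ≤ z) (hz1 : z < 1) (ht : t ≤ 1) :
    1 - z * dualMap z t = (1 - z) / (1 - z * t) := by
  rw [dualMap, eq_div_iff (one_sub_mul_pos hz0 hz1 ht).ne', sub_mul, mul_assoc, div_mul_cancel₀ _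
    (one_sub_mul_pos hz0 hz1 ht).ne']
  ring

lemma dualMap_dualMap (hz0 : 0 ≤ z) (hz1 : z < 1) (ht : t ≤ 1) :
    dualMap z (dualMap z t) = t := by
  have h := (one_sub_mul_pos hz0 hz1 ht).ne'
  have h' : 1 - z ≠ 0 := by linarith
  rw [dualMap, one_sub_dualMap hz0 hz1 ht, one_sub_mul_dualMap hz0 hz1 ht]
  field_simp

lemma dualMap_mem_Icc (hz0 : 0 ≤ z) (hz1 : z < 1) (ht : t ∈ Icc (0 : ℝ) 1) :
    dualMap z t ∈ Icc (0 : ℝ) 1 := by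
  have h := one_sub_mul_pos hz0 hz1 ht.2
  refine ⟨div_nonneg (by linarith [ht.2]) h.le, ?_⟩
  rw [dualMap, div_le_one h]
  nlinarith [ht.1]

lemma dualMap_lt_dualMap {s : ℝ} (hz0 : 0 ≤ z) (hz1 : z < 1) (hst : s < t) (ht : t ≤ 1) :
    dualMap z t < dualMap z s := by
  have h := one_sub_mul_pos hz0 hz1 ht
  have h' := one_sub_mul_pos hz0 hz1 (hst.le.trans ht)
  rw [dualMap, dualMap, div_lt_div_iff₀ h h']
  nlinarith

lemma hasDerivAt_dualMap (hz0 : 0 ≤ z) (hz1 : z < 1) (ht : t ≤ 1) :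
    HasDerivAt (dualMap z) (-(1 - z) / (1 - z * t) ^ 2) t := by
  have h := one_sub_mul_pos hz0 hz1 ht
  have h1 : HasDerivAt (fun s : ℝ => 1 - s) (-1) t := (hasDerivAt_id t).const_sub 1
  have h2 : HasDerivAt (fun s : ℝ => 1 - z * s) (-(z * 1)) t :=
    ((hasDerivAt_id t).const_mul z).const_sub 1
  exact (h1.div h2 h.ne').congr_deriv (by ring)

lemma image_dualMap_Ioo (hz0 : 0 ≤ z) (hz1 : z < 1) (ht : t ∈ Icc (0 : ℝ) 1) :
    dualMap z '' Ioo 0 (dualMap z t) = Ioo t 1 := by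
  have h0 : dualMap z 0 = 1 := by simp [dualMap]
  have h1 : dualMap z 1 = 0 := by simp [dualMap]
  have hφ := dualMap_mem_Icc hz0 hz1 ht
  ext s
  constructor
  · rintro ⟨u, hu, rfl⟩
    refine ⟨?_, ?_⟩
    · simpa [dualMap_dualMap hz0 hz1 ht.2] using dualMap_lt_dualMap hz0 hz1 hu.2 hφ.2
    · simpa [h0] using dualMap_lt_dualMap hz0 hz1 hu.1 (hu.2.le.trans hφ.2)
  · intro hs
    refine ⟨dualMap z s, ⟨?_, dualMap_lt_dualMap hz0 hz1 hs.1 hs.2.le⟩,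
      dualMap_dualMap hz0 hz1 hs.2.le⟩
    simpa [h1] using dualMap_lt_dualMap hz0 hz1 hs.2 le_rfl

lemma letterDensity_dualMap (hz0 : 0 ≤ z) (hz1 : z < 1) (ht : t ∈ Ioo (0 : ℝ) 1) (a : Letter) :
    ENNReal.ofReal |-(1 - z) / (1 - z * t) ^ 2| * letterDensity z a (dualMap z t)
      = letterDensity z (swapLetter a) t := by
  have h := one_sub_mul_pos hz0 hz1 ht.2.le
  have hz : 0 < 1 - z := by linarith
  have ht0 := ht.1
  have ht1 : 0 < 1 - t := by linarith [ht.2]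
  have habs : |-(1 - z) / (1 - z * t) ^ 2| = (1 - z) / (1 - z * t) ^ 2 := by
    rw [neg_div, abs_neg, abs_of_pos (by positivity)]
  rw [habs]
  cases a <;> simp only [letterDensity, swapLetter] <;>
    rw [← ENNReal.ofReal_mul (by positivity)] <;> congr 1
  · rw [dualMap]; field_simp
  · rw [one_sub_mul_dualMap hz0 hz1 ht.2.le]; field_simp
  · rw [one_sub_mul_dualMap hz0 hz1 ht.2.le, one_sub_dualMap hz0 hz1 ht.2.le]; field_simp

lemma upperInt_eq_lowerInt_dualMap (hz0 : 0 ≤ z) (hz1 : z < 1) (w : List Letter) :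
    ∀ {t : ℝ}, t ∈ Icc (0 : ℝ) 1 →
      upperInt z w t = lowerInt z (w.map swapLetter) (dualMap z t) := by
  induction w with
  | nil => intro t _; rfl
  | cons a w ih =>
    intro t ht
    have hφ := dualMap_mem_Icc hz0 hz1 ht
    have hmem : ∀ u ∈ Ioo 0 (dualMap z t), u ∈ Ioo (0 : ℝ) 1 :=
      fun u hu => ⟨hu.1, hu.2.trans_le hφ.2⟩
    have hinj : InjOn (dualMap z) (Ioo 0 (dualMap z t)) := fun u hu v hv huv => by
      rw [← dualMap_dualMap hz0 hz1 (hmem u hu).2.le, huv,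
        dualMap_dualMap hz0 hz1 (hmem v hv).2.le]
    rw [List.map_cons, upperInt, lowerInt, ← image_dualMap_Ioo hz0 hz1 ht,
      lintegral_image_eq_lintegral_abs_deriv_mul measurableSet_Ioo
        (fun u hu => (hasDerivAt_dualMap hz0 hz1 (hmem u hu).2.le).hasDerivWithinAt) hinj]
    refine setLIntegral_congr_fun measurableSet_Ioo fun u hu => ?_
    have hu' := hmem u hu
    rw [← mul_assoc, letterDensity_dualMap hz0 hz1 hu',
      ih (dualMap_mem_Icc hz0 hz1 (Ioo_subset_Icc_self hu')),
      dualMap_dualMap hz0 hz1 hu'.2.le]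

lemma lowerInt_reverse_one_eq_map_swap (hz0 : 0 ≤ z) (hz1 : z < 1) (w : List Letter) :
    lowerInt z w.reverse 1 = lowerInt z (w.map swapLetter) 1 := by
  rw [lowerInt_reverse_one, upperInt_eq_lowerInt_dualMap hz0 hz1 w ⟨le_rfl, zero_le_one⟩]
  simp [dualMap]

end dualMap

section series

variable {z : ℝ}

lemma lintegral_Ioo_pow (n : ℕ) {t : ℝ} (ht : 0 ≤ t) :
    ∫⁻ s in Ioo 0 t, ENNReal.ofReal (s ^ n)
      = ENNReal.ofReal (1 / ((n + 1 : ℕ) : ℝ)) * ENNReal.ofReal (t ^ (n + 1)) := by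
  rw [setLIntegral_congr Ioo_ae_eq_Ioc, ← ofReal_integral_eq_lintegral_ofReal,
    ← intervalIntegral.integral_of_le ht, integral_pow, ← ENNReal.ofReal_mul (by positivity)]
  · congr 1; push_cast; simp; ring
  · exact (intervalIntegrable_iff_integrableOn_Ioc_of_le ht).1
      (intervalIntegral.intervalIntegrable_pow n)
  · exact (ae_restrict_iff' measurableSet_Ioc).2 (ae_of_all _ fun s hs => pow_nonneg hs.1.le n)

/-- The numerator `μ + (-1)^μ z^n`. -/
noncomputable def augNumerator (z : ℝ) (μ : Bool) (n : ℕ) : ℝ :=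
  (if μ then 1 else 0) + (if μ then -1 else 1) * z ^ n

lemma augNumerator_nonneg (hz0 : 0 ≤ z) (hz1 : z < 1) (μ : Bool) (n : ℕ) :
    0 ≤ augNumerator z μ n := by
  have h0 := pow_nonneg hz0 n
  have h1 := pow_le_one₀ (n := n) hz0 hz1.le
  cases μ <;> simp [augNumerator, h0, h1]

lemma letterDensity_y_eq_tsum (hz0 : 0 ≤ z) (hz1 : z < 1) (μ : Bool) {s : ℝ}
    (hs : s ∈ Ioo (0 : ℝ) 1) :
    letterDensity z (if μ then .y1 else .y0) s
      = ∑' d : ℕ, ENNReal.ofReal (augNumerator z μ (d + 1)) * ENNReal.ofReal (s ^ d) := by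
  have h := one_sub_mul_pos hz0 hz1 hs.2.le
  have hs1 : 0 < 1 - s := by linarith [hs.2]
  have hzs : HasSum (fun d : ℕ => z ^ (d + 1) * s ^ d) (z / (1 - z * s)) := by
    have := (hasSum_geometric_of_lt_one (mul_nonneg hz0 hs.1.le) (by linarith)).mul_left z
    rw [← div_eq_mul_inv] at this
    exact this.congr_fun fun d => by rw [mul_pow]; ring
  have hone := hasSum_geometric_of_lt_one hs.1.le hs.2
  simp_rw [← ENNReal.ofReal_mul (augNumerator_nonneg hz0 hz1 μ _)]
  have key : ∀ a : ℝ, HasSum (fun d : ℕ => augNumerator z μ (d + 1) * s ^ d) a →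
      ENNReal.ofReal a = ∑' d : ℕ, ENNReal.ofReal (augNumerator z μ (d + 1) * s ^ d) := by
    intro a ha
    rw [← ha.tsum_eq, ENNReal.ofReal_tsum_of_nonneg (fun d => mul_nonneg
      (augNumerator_nonneg hz0 hz1 μ _) (pow_nonneg hs.1.le _)) ha.summable]
  cases μ
  · refine key _ ?_
    simpa [augNumerator] using hzs
  · refine key _ ?_
    have hval : (1 - z) / ((1 - s) * (1 - z * s)) = (1 - s)⁻¹ - z / (1 - z * s) := by
      rw [inv_eq_one_div, div_sub_div _ _ hs1.ne' h.ne']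
      ring
    rw [hval]
    exact (hone.sub hzs).congr_fun fun d => by simp [augNumerator]; ring

/-- `lowerInt z w` is on `[0, 1]` the power series `∑ c i * t ^ m i`. -/
def LowerIntHasSeries (z : ℝ) (w : List Letter) {ι : Type*} (c : ι → ℝ≥0∞) (m : ι → ℕ) : Prop :=
  ∀ t ∈ Icc (0 : ℝ) 1, lowerInt z w t = ∑' i, c i * ENNReal.ofReal (t ^ m i)

lemma LowerIntHasSeries.cons_x {w : List Letter} {ι : Type*} [Countable ι]
    {c : ι → ℝ≥0∞} {m : ι → ℕ} (hm : ∀ i, 1 ≤ m i) (h : LowerIntHasSeries z w c m) :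
    LowerIntHasSeries z (.x :: w) (fun i => c i * ENNReal.ofReal (1 / m i)) m := by
  intro t ht
  have hcongr : lowerInt z (.x :: w) t
      = ∫⁻ s in Ioo 0 t, ∑' i, c i * ENNReal.ofReal (s ^ (m i - 1)) := by
    refine setLIntegral_congr_fun measurableSet_Ioo fun s hs => ?_
    rw [h s ⟨hs.1.le, hs.2.le.trans ht.2⟩, ← ENNReal.tsum_mul_left]
    refine tsum_congr fun i => ?_
    have hs0 : 0 < s := hs.1
    obtain ⟨n, hn⟩ := Nat.exists_eq_add_of_le' (hm i)
    rw [letterDensity, mul_left_comm, ← ENNReal.ofReal_mul (by positivity), hn,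
      Nat.add_sub_cancel]
    congr 2
    field_simp
    exact pow_succ' s n
  rw [hcongr, lintegral_tsum fun i => by fun_prop]
  refine tsum_congr fun i => ?_
  rw [lintegral_const_mul _ (by fun_prop), lintegral_Ioo_pow _ ht.1, Nat.sub_add_cancel (hm i),
    mul_assoc]

lemma LowerIntHasSeries.replicate_x {w : List Letter} {ι : Type*} [Countable ι]
    {c : ι → ℝ≥0∞} {m : ι → ℕ} (hm : ∀ i, 1 ≤ m i) (h : LowerIntHasSeries z w c m) (k : ℕ) :
    LowerIntHasSeries z (List.replicate k .x ++ w)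
      (fun i => c i * ENNReal.ofReal (1 / m i) ^ k) m := by
  induction k with
  | zero => simpa using h
  | succ k ih =>
    simpa only [List.replicate_succ, List.cons_append, pow_succ, mul_assoc] using ih.cons_x hm

lemma LowerIntHasSeries.cons_y (hz0 : 0 ≤ z) (hz1 : z < 1) {w : List Letter} {ι : Type*}
    [Countable ι] {c : ι → ℝ≥0∞} {m : ι → ℕ} (h : LowerIntHasSeries z w c m) (μ : Bool) :
    LowerIntHasSeries z ((if μ then .y1 else .y0) :: w)
      (fun p : ι × ℕ => c p.1 * ENNReal.ofReal (augNumerator z μ (p.2 + 1))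
        * ENNReal.ofReal (1 / (m p.1 + p.2 + 1 : ℕ)))
      (fun p => m p.1 + p.2 + 1) := by
  intro t ht
  have hcongr : lowerInt z ((if μ then .y1 else .y0) :: w) t
      = ∫⁻ s in Ioo 0 t, ∑' p : ι × ℕ,
        c p.1 * ENNReal.ofReal (augNumerator z μ (p.2 + 1))
          * ENNReal.ofReal (s ^ (m p.1 + p.2)) := by
    refine setLIntegral_congr_fun measurableSet_Ioo fun s hs => ?_
    rw [h s ⟨hs.1.le, hs.2.le.trans ht.2⟩,
      letterDensity_y_eq_tsum hz0 hz1 μ ⟨hs.1, hs.2.trans_le ht.2⟩, ENNReal.tsum_prod',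
      ← ENNReal.tsum_mul_left]
    refine tsum_congr fun i => ?_
    rw [← ENNReal.tsum_mul_right]
    refine tsum_congr fun d => ?_
    rw [pow_add, ENNReal.ofReal_mul (pow_nonneg hs.1.le _)]
    ring
  rw [hcongr, lintegral_tsum fun i => by fun_prop]
  refine tsum_congr fun p => ?_
  rw [lintegral_const_mul _ (by fun_prop), lintegral_Ioo_pow _ ht.1, ← mul_assoc]

lemma chain_snoc_of_le {r : ℕ} (d : Fin r → ℕ) (e : ℕ) {i : ℕ} (hi : i ≤ r) :
    chain (Fin.snoc d e : Fin (r + 1) → ℕ) i = chain d i := by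
  simp [chain, Finset.sum_filter, Fin.sum_univ_castSucc, hi.not_gt]

lemma chain_snoc_last {r : ℕ} (d : Fin r → ℕ) (e : ℕ) :
    chain (Fin.snoc d e : Fin (r + 1) → ℕ) (r + 1) = chain d r + e + 1 := by
  simp [chain, Finset.sum_filter, Fin.sum_univ_castSucc, add_assoc]

lemma termFactor_eq (z : ℝ) (k : ℕ) (μ : Bool) (a b : ℕ) :
    termFactor z k μ a b = augNumerator z μ (b - a) / (b : ℝ) ^ k := rfl

lemma termFactor_nonneg (hz0 : 0 ≤ z) (hz1 : z < 1) (k : ℕ) (μ : Bool) (a b : ℕ) :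
    0 ≤ termFactor z k μ a b :=
  div_nonneg (augNumerator_nonneg hz0 hz1 μ _) (by positivity)

lemma reverse_word_ofFn_succ {r : ℕ} (f : Fin (r + 1) → ℕ × Bool) :
    (word (List.ofFn f)).reverse
      = List.replicate ((f (Fin.last r)).1 - 1) .x ++
        (if (f (Fin.last r)).2 then .y1 else .y0) ::
          (word (List.ofFn fun i : Fin r => f i.castSucc)).reverse := by
  rw [List.ofFn_succ']
  simp [word]

lemma lowerIntHasSeries_word (hz0 : 0 ≤ z) (hz1 : z < 1) {r : ℕ} (f : Fin r → ℕ × Bool)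
    (hf : ∀ i, 1 ≤ (f i).1) :
    LowerIntHasSeries z (word (List.ofFn f)).reverse
      (fun d : Fin r → ℕ => ∏ i : Fin r,
        ENNReal.ofReal (termFactor z (f i).1 (f i).2 (chain d i) (chain d (i + 1))))
      (fun d => chain d r) := by
  induction r with
  | zero => intro t _; simp [word, lowerInt, chain]
  | succ r ih =>
    intro t ht
    have h := ((ih (fun i => f i.castSucc) fun i => hf _).cons_y hz0 hz1
      (f (Fin.last r)).2).replicate_x (fun _ => Nat.le_add_left 1 _)
        ((f (Fin.last r)).1 - 1) t ht
    rw [reverse_word_ofFn_succ, h,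
      ← ((Equiv.prodComm _ _).trans (Fin.snocEquiv fun _ : Fin (r + 1) => ℕ)).tsum_eq]
    refine tsum_congr fun p => ?_
    obtain ⟨d, e⟩ := p
    obtain ⟨k, hk⟩ := Nat.exists_eq_add_of_le' (hf (Fin.last r))
    have he : ((Equiv.prodComm _ _).trans (Fin.snocEquiv fun _ : Fin (r + 1) => ℕ)) (d, e)
      = (Fin.snoc d e : Fin (r + 1) → ℕ) := rfl
    have hlast : chain d r + e + 1 - chain d r = e + 1 := by omega
    have hcast : ∀ i : Fin r, chain (Fin.snoc d e : Fin (r + 1) → ℕ) i = chain d i :=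
      fun i => chain_snoc_of_le d e i.2.le
    have hsucc : ∀ i : Fin r, chain (Fin.snoc d e : Fin (r + 1) → ℕ) (i + 1) = chain d (i + 1) :=
      fun i => chain_snoc_of_le d e i.2
    rw [he]
    simp only [Fin.prod_univ_castSucc, Fin.val_castSucc, Fin.val_last, hcast, hsucc, chain_snoc_last,
      chain_snoc_of_le d e le_rfl, hk, Nat.add_sub_cancel]
    rw [termFactor_eq z _ _ (chain d r), hlast, div_eq_mul_one_div (augNumerator _ _ _), ← one_div_pow,
      ENNReal.ofReal_mul (augNumerator_nonneg hz0 hz1 _ _),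
      ENNReal.ofReal_pow (p := 1 / _) (by positivity), pow_succ' (ENNReal.ofReal (1 / _))]
    ring

lemma Li_eq_toReal_lowerInt (hz0 : 0 ≤ z) (hz1 : z < 1) {K : AugIndex} (hK : K.Valid) :
    Li K z = (lowerInt z (word K).reverse 1).toReal := by
  have h := lowerIntHasSeries_word hz0 hz1 K.get (fun i => hK _ (K.get_mem i)) 1
    ⟨zero_le_one, le_rfl⟩
  rw [List.ofFn_get] at h
  simp only [one_pow, ENNReal.ofReal_one, mul_one] at h
  rw [h, ENNReal.tsum_toReal_eq fun d => ENNReal.prod_ne_top fun _ _ => ENNReal.ofReal_ne_top]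
  refine tsum_congr fun d => ?_
  rw [ENNReal.toReal_prod]
  exact Finset.prod_congr rfl fun i _ =>
    (ENNReal.toReal_ofReal (termFactor_nonneg hz0 hz1 _ _ _ _)).symm

end series

/-- Duality of one-variable multiple polylogarithms: L̃i(k̃; z) = L̃i(k̃†; z), where the
dual k̃† is the admissible augmented index whose word is obtained from w(k̃) by reversing
and exchanging x ↔ y₁. -/
theorem Li_duality (z : ℝ) (hz0 : 0 ≤ z) (hz1 : z < 1) (K Kd : AugIndex)
    (hK : K.Valid) (hKd : Kd.Valid) (hKadm : K.Admissible) (hKdadm : Kd.Admissible)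
    (hdual : word Kd = (word K).reverse.map swapLetter) :
    Li K z = Li Kd z := by
  rw [Li_eq_toReal_lowerInt hz0 hz1 hK, Li_eq_toReal_lowerInt hz0 hz1 hKd, hdual,
    lowerInt_reverse_one_eq_map_swap hz0 hz1, ← List.map_reverse, List.reverse_reverse]
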